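/- Let A ≤ GL₂(k̄) be a Galois-stable subgroup isomorphic as an abstract group to the dihedral group D12 of order 12, with fields K and K₁ = k(√u) (u ∈ k*). For d ∈ k*, say that P(d) holds if there exists W ∈ A with σ(W) = χ_d(σ)·W for all σ ∈ G_k. Then: if 3 does not divide [K:k], P(d) holds if and only if d ∈ k*² ∪ u·k*²; if 3 divides [K:k], P(d) holds if and only if d ∈ k*². (This computes the image of the connecting map δ : A'^{G_k} → H¹(G_k,{±1}) ≅ k*/k*² of Proposition 4.1 in the D12 case.) -/

import Mathlib

open Matrix IntermediateField

noncomputable section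

/-- The absolute Galois group of `k`. -/
abbrev Gk (k : Type*) [Field k] := AlgebraicClosure k ≃ₐ[k] AlgebraicClosure k

/-- The entrywise Galois action on `GL₂(k̄)`, as a homomorphism to automorphisms. -/
def galHom (k : Type*) [Field k] :
    Gk k →* MulAut (GL (Fin 2) (AlgebraicClosure k)) where
  toFun σ := Units.mapEquiv σ.mapMatrix.toRingEquiv.toMulEquiv
  map_one' := by
    ext M i j
    simp [AlgEquiv.mapMatrix_apply]
  map_mul' σ τ := by
    ext M i j
    simp [AlgEquiv.mapMatrix_apply]

/-- The pointwise stabilizer in `G_k` of a subgroup `A ≤ GL₂(k̄)`; its fixed field is the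
field of definition `K` of the Galois action on `A`. -/
def stabSub {k : Type*} [Field k] (A : Subgroup (GL (Fin 2) (AlgebraicClosure k))) :
    Subgroup (Gk k) where
  carrier := {σ | ∀ M ∈ A, galHom k σ M = M}
  one_mem' := fun M _ => by simp
  mul_mem' := by
    intro σ τ hσ hτ M hM
    rw [_root_.map_mul]
    have : galHom k σ (galHom k τ M) = M := by rw [hτ M hM, hσ M hM]
    simpa using this
  inv_mem' := by
    intro σ hσ M hM
    rw [_root_.map_inv]
    exact (MulEquiv.symm_apply_eq _).mpr (hσ M hM).symm

/-- `P(d)` for a square root `sd` of `d` : there is `W ∈ A` with `σ(W) = χ_d(σ)·W` for all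
`σ ∈ G_k`, where `χ_d(σ) ∈ {±1}` is defined by `σ(√d) = χ_d(σ)·√d`. -/
def Pcond (k : Type*) [Field k] (A : Subgroup (GL (Fin 2) (AlgebraicClosure k)))
    (sd : AlgebraicClosure k) : Prop :=
  ∃ W ∈ A, ∀ σ : Gk k,
    (σ sd = sd ∧ galHom k σ W = W) ∨ (σ sd = -sd ∧ galHom k σ W = -W)

namespace DihedralGroup

theorem exists_affine (φ : MulAut (DihedralGroup 6)) :
    ∃ e j : ZMod 6, (e = 1 ∨ e = -1) ∧ (∀ i, φ (r i) = r (e * i)) ∧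
      ∀ i, φ (sr i) = sr (j + e * i) := by
  have hinj := φ.injective
  have hr : ∃ e, φ (r 1) = r e := by
    rcases h : φ (r 1) with e | j
    · exact ⟨e, rfl⟩
    · exfalso
      have h1 : φ (r 1 * r 1) = φ 1 := by rw [map_mul, h, map_one, sr_mul_self]
      exact absurd (hinj h1) (by decide)
  obtain ⟨e, he⟩ := hr
  have hpow : ∀ n : ℕ, φ (r (n : ZMod 6)) = r (e * (n : ZMod 6)) := fun n => by
    rw [← r_one_pow, map_pow, he, r_pow]
  have hri : ∀ i : ZMod 6, φ (r i) = r (e * i) := fun i => by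
    simpa using hpow i.val
  have he1 : e = 1 ∨ e = -1 := by
    have h2 : e * 2 ≠ 0 := fun h => by
      have := hri 2
      rw [h, ← one_def, ← map_one φ] at this
      exact absurd (hinj this) (by decide)
    have h3 : e * 3 ≠ 0 := fun h => by
      have := hri 3
      rw [h, ← one_def, ← map_one φ] at this
      exact absurd (hinj this) (by decide)
    clear he hpow hri
    revert e; decide
  have hs : ∃ j, φ (sr 0) = sr j := by
    rcases h : φ (sr 0) with m | j
    · exfalso
      have h1 : φ (sr 0 * r 1) = φ (r 1 * sr 0) := by
        rw [map_mul, map_mul, h, he, r_mul_r, r_mul_r, add_comm]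
      exact absurd (hinj h1) (by decide)
    · exact ⟨j, rfl⟩
  obtain ⟨j, hj⟩ := hs
  refine ⟨e, j, he1, hri, fun i => ?_⟩
  have : (sr i : DihedralGroup 6) = sr 0 * r i := by simp
  rw [this, map_mul, hj, hri, sr_mul_r]

variable {G : Type*} [Group G] (ρ : G →* MulAut (DihedralGroup 6))

theorem two_mul_translation_eq_zero (h3 : ¬ 3 ∣ Nat.card ρ.range) (σ : G) (j : ZMod 6)
    (hr : ∀ i, ρ σ (r i) = r i) (hs : ∀ i, ρ σ (sr i) = sr (j + i)) : 2 * j = 0 := by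
  have hcube : (ρ σ ^ 2) ^ 3 = 1 := by
    ext x
    rcases x with i | i
    · simp [pow_succ, hr]
    · simp only [pow_succ, pow_zero, one_mul, MulAut.mul_apply, hs, MulAut.one_apply, sr.injEq]
      clear hs
      revert i j; decide
  have hdvd : orderOf (ρ σ ^ 2) ∣ Nat.card ρ.range := by
    have : ρ σ ^ 2 = ((⟨ρ (σ ^ 2), σ ^ 2, rfl⟩ : ρ.range) : MulAut (DihedralGroup 6)) := by simp
    rw [this, Subgroup.orderOf_coe]
    exact orderOf_dvd_natCard _
  have hone : ρ σ ^ 2 = 1 := by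
    rcases (Nat.dvd_prime Nat.prime_three).1 (orderOf_dvd_of_pow_eq_one hcube) with h | h
    · exact orderOf_eq_one_iff.1 h
    · exact absurd (h ▸ hdvd) h3
  have := DFunLike.congr_fun hone (sr 0)
  simp only [pow_two, MulAut.mul_apply, hs, MulAut.one_apply, sr.injEq] at this
  linear_combination this

theorem exists_reflection_stable_up_to_center (h3 : ¬ 3 ∣ Nat.card ρ.range) :
    ∃ i, ∀ σ, ρ σ (sr i) = sr i ∨ ρ σ (sr i) = r 3 * sr i := by
  have key : ∀ i x : ZMod 6, 2 * (x - i) = 0 →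
      (sr x : DihedralGroup 6) = sr i ∨ (sr x : DihedralGroup 6) = r 3 * sr i := by decide
  by_cases h : ∃ σ, ∃ j, (∀ i, ρ σ (r i) = r (-1 * i)) ∧ ∀ i, ρ σ (sr i) = sr (j + -1 * i)
  · obtain ⟨σ, j, hr, hs⟩ := h
    refine ⟨2 * j, fun τ => ?_⟩
    obtain ⟨e, l, he, hr', hs'⟩ := exists_affine (ρ τ)
    rw [hs']
    apply key
    rcases he with rfl | rfl
    · have := two_mul_translation_eq_zero ρ h3 τ l (by simpa using hr') (by simpa using hs')
      linear_combination this
    · have := two_mul_translation_eq_zero ρ h3 (σ * τ) (j - l)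
        (fun i => by simp [hr, hr']) (fun i => by
          rw [map_mul, MulAut.mul_apply, hs', hs]; congr 1; ring)
      have h6 : (6 : ZMod 6) = 0 := rfl
      linear_combination -this - j * h6
  · refine ⟨0, fun τ => ?_⟩
    obtain ⟨e, l, he, hr', hs'⟩ := exists_affine (ρ τ)
    rcases he with rfl | rfl
    · have := two_mul_translation_eq_zero ρ h3 τ l (by simpa using hr') (by simpa using hs')
      rw [hs']
      apply key
      linear_combination this
    · exact absurd ⟨τ, l, hr', hs'⟩ h

theorem exists_moves_reflections (h3 : 3 ∣ Nat.card ρ.range) :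
    ∃ σ, ∀ i, ¬ (ρ σ (sr i) = sr i ∨ ρ σ (sr i) = r 3 * sr i) := by
  have : Finite (MulAut (DihedralGroup 6)) := DFunLike.finite _
  have := Fact.mk Nat.prime_three
  obtain ⟨⟨_, σ, rfl⟩, hσ⟩ := exists_prime_orderOf_dvd_card' 3 h3
  rw [← Subgroup.orderOf_coe] at hσ
  have hcube : ρ σ ^ 3 = 1 := hσ ▸ pow_orderOf_eq_one (ρ σ)
  have hne : ρ σ ≠ 1 := fun h => by
    rw [← orderOf_eq_one_iff] at h
    simp_all
  obtain ⟨e, j, he, hr, hs⟩ := exists_affine (ρ σ)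
  have h1 := DFunLike.congr_fun hcube (r 1)
  have h2 := DFunLike.congr_fun hcube (sr 0)
  simp only [pow_succ, pow_zero, one_mul, MulAut.mul_apply, hr, hs, MulAut.one_apply, r.injEq,
    sr.injEq] at h1 h2
  rcases he with rfl | rfl
  · have hj : j ≠ 0 := by
      rintro rfl
      apply hne
      ext x
      rcases x with i | i <;> simp [hr, hs]
    refine ⟨σ, fun i => ?_⟩
    rw [hs]
    clear hr hs
    revert i j; decide
  · exact absurd h1 (by decide)

theorem r_three_mul_ne (x : DihedralGroup 6) : r 3 * x ≠ x :=
  fun h => absurd (mul_eq_right.1 h) (by decide)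

theorem apply_r_ne (φ : MulAut (DihedralGroup 6)) (i : ZMod 6) : φ (r i) ≠ r 3 * r i := by
  obtain ⟨e, j, he, hr, -⟩ := exists_affine φ
  rw [hr]
  rcases he with rfl | rfl <;> revert i <;> decide

theorem forall_mul_inv_mem_iff (φ : MulAut (DihedralGroup 6)) (i : ZMod 6)
    (h : φ (sr i) = sr i ∨ φ (sr i) = r 3 * sr i) :
    (∀ m, φ m * m⁻¹ = 1 ∨ φ m * m⁻¹ = r 2 ∨ φ m * m⁻¹ = r 4) ↔ φ (sr i) = sr i := by
  obtain ⟨e, j, he, hr, hs⟩ := exists_affine φ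
  constructor
  · intro hm
    rcases h with h | h
    · exact h
    · have := hm (sr i)
      rw [h] at this
      exfalso
      revert this
      clear h hm hs hr
      revert i; decide
  · intro hi m
    rw [hs] at hi
    clear h
    rcases m with m | m
    · rw [hr]
      clear hr hs
      rcases he with rfl | rfl <;> clear hi <;> revert m <;> decide
    · rw [hs]
      clear hr hs
      rcases he with rfl | rfl <;> revert i j m <;> decide

theorem eq_r_of_orderOf_eq_six {x : DihedralGroup 6} (hx : orderOf x = 6) :
    ∃ v, x = r v ∧ (v = 1 ∨ v = 5) := by
  rcases x with v | v
  · refine ⟨v, rfl, ?_⟩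
    rw [orderOf_r] at hx
    revert v; decide
  · rw [orderOf_sr] at hx
    exact absurd hx (by decide)

end DihedralGroup

section Matrices

variable {K : Type*} [Field K]

theorem Matrix.commute_of_commute_of_ne_scalar {M X Y : Matrix (Fin 2) (Fin 2) K}
    (hM : M ≠ Matrix.scalar (Fin 2) (M 0 0)) (hX : Commute X M) (hY : Commute Y M) :
    Commute X Y := by
  have eX := fun i j => congrFun (congrFun hX.eq i) j
  have eY := fun i j => congrFun (congrFun hY.eq i) j
  have x00 := eX 0 0
  have x01 := eX 0 1
  have x10 := eX 1 0
  have y00 := eY 0 0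
  have y01 := eY 0 1
  have y10 := eY 1 0
  simp only [Matrix.mul_apply, Fin.sum_univ_two] at x00 x01 x10 y00 y01 y10
  have hne : M 0 1 ≠ 0 ∨ M 1 0 ≠ 0 ∨ M 1 1 - M 0 0 ≠ 0 := by
    by_contra! h
    obtain ⟨h1, h2, h3⟩ := h
    apply hM
    ext i j
    fin_cases i <;> fin_cases j <;> simp [h1, h2, sub_eq_zero.1 h3]
  have p1 : X 0 1 * Y 1 0 = Y 0 1 * X 1 0 := by
    rcases hne with h | h | h <;> apply mul_left_cancel₀ h <;> grind
  have p2 : X 0 1 * (Y 1 1 - Y 0 0) = Y 0 1 * (X 1 1 - X 0 0) := by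
    rcases hne with h | h | h <;> apply mul_left_cancel₀ h <;> grind
  have p3 : X 1 0 * (Y 1 1 - Y 0 0) = Y 1 0 * (X 1 1 - X 0 0) := by
    rcases hne with h | h | h <;> apply mul_left_cancel₀ h <;> grind
  ext i j
  fin_cases i <;> fin_cases j <;> simp [Matrix.mul_apply, Fin.sum_univ_two] <;> grind

theorem Matrix.GeneralLinearGroup.eq_neg_one_of_central_involution
    {X Y Z : GL (Fin 2) K} (hXY : X * Y ≠ Y * X)
    (hX : X * Z = Z * X) (hY : Y * Z = Z * Y) (hZ : Z * Z = 1) (hZ1 : Z ≠ 1) : Z = -1 := by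
  have hs : (Z : Matrix (Fin 2) (Fin 2) K) = Matrix.scalar (Fin 2) (Z.val 0 0) := by
    by_contra h
    exact hXY (Units.ext (Matrix.commute_of_commute_of_ne_scalar h
      (Units.ext_iff.1 hX) (Units.ext_iff.1 hY)).eq)
  generalize Z.val 0 0 = c at hs
  have hc : c * c = 1 := by
    have := congrArg (fun g : GL (Fin 2) K => g.val 0 0) hZ
    rw [Units.val_mul, hs] at this
    simpa using this
  rcases mul_self_eq_one_iff.1 hc with rfl | rfl
  · exact absurd (Units.ext (by rw [hs, map_one]; rfl)) hZ1
  · exact Units.ext (by rw [hs, map_neg, map_one]; rfl)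

end Matrices

section SquareRoots

variable {k : Type*} [Field k]

theorem apply_sqrt_eq_or_neg {d : k} {s : AlgebraicClosure k}
    (hs : s ^ 2 = algebraMap k (AlgebraicClosure k) d) (σ : Gk k) : σ s = s ∨ σ s = -s := by
  rw [← sq_eq_sq_iff_eq_or_eq_neg, ← map_pow, hs, σ.commutes]

theorem sqrt_ne_neg (hchar2 : (2 : k) ≠ 0) {d : k} (hd : d ≠ 0) {s : AlgebraicClosure k}
    (hs : s ^ 2 = algebraMap k (AlgebraicClosure k) d) : s ≠ -s := by
  intro h
  have h2 : (2 : AlgebraicClosure k) ≠ 0 := by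
    rw [← map_ofNat (algebraMap k (AlgebraicClosure k)) 2]
    exact (map_ne_zero _).2 hchar2
  have : s = 0 := by
    have : 2 * s = 0 := by linear_combination h
    simpa [h2] using this
  rw [this, zero_pow two_ne_zero, eq_comm, map_eq_zero] at hs
  exact hd hs

variable [PerfectField k]

theorem exists_eq_of_fixed (x : AlgebraicClosure k) (h : ∀ σ : Gk k, σ x = x) :
    ∃ c : k, algebraMap k (AlgebraicClosure k) c = x :=
  (InfiniteGalois.mem_range_algebraMap_iff_fixed x).2 h

theorem isSquare_iff_sqrt_fixed {d : k} (hd : d ≠ 0) {s : AlgebraicClosure k}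
    (hs : s ^ 2 = algebraMap k (AlgebraicClosure k) d) :
    (∃ c : k, c ≠ 0 ∧ d = c ^ 2) ↔ ∀ σ : Gk k, σ s = s := by
  constructor
  · rintro ⟨c, -, rfl⟩ σ
    rw [map_pow, sq_eq_sq_iff_eq_or_eq_neg] at hs
    rcases hs with rfl | rfl <;> simp
  · intro h
    obtain ⟨c, rfl⟩ := exists_eq_of_fixed s h
    have hc : d = c ^ 2 := (algebraMap k (AlgebraicClosure k)).injective (by rw [map_pow, hs])
    exact ⟨c, by rintro rfl; simp_all, hc⟩

theorem eq_mul_sq_iff_sqrt_fixed_iff (hchar2 : (2 : k) ≠ 0) {d u : k} (hd : d ≠ 0) (hu : u ≠ 0)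
    {s t : AlgebraicClosure k} (hs : s ^ 2 = algebraMap k (AlgebraicClosure k) d)
    (ht : t ^ 2 = algebraMap k (AlgebraicClosure k) u) :
    (∃ c : k, c ≠ 0 ∧ d = u * c ^ 2) ↔ ∀ σ : Gk k, σ s = s ↔ σ t = t := by
  have hdu : (s * t) ^ 2 = algebraMap k (AlgebraicClosure k) (d * u) := by
    rw [mul_pow, hs, ht, map_mul]
  have hsn := sqrt_ne_neg hchar2 hd hs
  have htn := sqrt_ne_neg hchar2 hu ht
  have hs0 : s ≠ 0 := by rintro rfl; simp at hsn
  have ht0 : t ≠ 0 := by rintro rfl; simp at htn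
  have h1 : (∃ c : k, c ≠ 0 ∧ d = u * c ^ 2) ↔ ∃ c : k, c ≠ 0 ∧ d * u = c ^ 2 := by
    constructor
    · rintro ⟨c, hc, rfl⟩
      exact ⟨u * c, mul_ne_zero hu hc, by ring⟩
    · rintro ⟨c, hc, h⟩
      refine ⟨c / u, div_ne_zero hc hu, ?_⟩
      field_simp
      linear_combination h
  rw [h1, isSquare_iff_sqrt_fixed (mul_ne_zero hd hu) hdu]
  refine forall_congr' fun σ => ?_
  rw [map_mul]
  rcases apply_sqrt_eq_or_neg hs σ with h | h <;> rcases apply_sqrt_eq_or_neg ht σ with h' | h' <;>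
    rw [h, h']
  · simp
  · exact iff_of_false (fun e => htn (mul_left_cancel₀ hs0 e).symm) fun e => htn (e.1 rfl).symm
  · exact iff_of_false (fun e => hsn (mul_right_cancel₀ ht0 e).symm) fun e => hsn (e.2 rfl).symm
  · simp [hsn.symm, htn.symm]

end SquareRoots

section GaloisAction

variable {k : Type*} [Field k]

/-- The action of `G_k` on a Galois-stable subgroup `A`. -/
def galStable (A : Subgroup (GL (Fin 2) (AlgebraicClosure k)))
    (hA : ∀ σ : Gk k, ∀ M ∈ A, galHom k σ M ∈ A) : Gk k →* MulAut A where
  toFun σ :=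
    { toFun := fun M => ⟨galHom k σ M, hA σ M M.2⟩
      invFun := fun M => ⟨galHom k σ⁻¹ M, hA σ⁻¹ M M.2⟩
      left_inv := fun M => Subtype.ext (by
        change galHom k σ⁻¹ (galHom k σ M) = M
        rw [← MulAut.mul_apply, ← map_mul, inv_mul_cancel, map_one, MulAut.one_apply])
      right_inv := fun M => Subtype.ext (by
        change galHom k σ (galHom k σ⁻¹ M) = M
        rw [← MulAut.mul_apply, ← map_mul, mul_inv_cancel, map_one, MulAut.one_apply])
      map_mul' := fun M N => Subtype.ext ((galHom k σ).map_mul M N) }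
  map_one' := by
    ext1 M
    exact Subtype.ext (by change galHom k 1 M = M; rw [map_one, MulAut.one_apply])
  map_mul' σ τ := by
    ext1 M
    exact Subtype.ext (by
      change galHom k (σ * τ) M = galHom k σ (galHom k τ M)
      rw [map_mul, MulAut.mul_apply])

@[simp]
theorem coe_galStable_apply (A : Subgroup (GL (Fin 2) (AlgebraicClosure k)))
    (hA : ∀ σ : Gk k, ∀ M ∈ A, galHom k σ M ∈ A) (σ : Gk k) (M : A) :
    (galStable A hA σ M : GL (Fin 2) (AlgebraicClosure k)) = galHom k σ M := rfl

theorem ker_galStable (A : Subgroup (GL (Fin 2) (AlgebraicClosure k)))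
    (hA : ∀ σ : Gk k, ∀ M ∈ A, galHom k σ M ∈ A) : (galStable A hA).ker = stabSub A := by
  ext σ
  rw [MonoidHom.mem_ker]
  constructor
  · intro h M hM
    simpa using congrArg Subtype.val (DFunLike.congr_fun h ⟨M, hM⟩)
  · intro h
    ext1 M
    exact Subtype.ext (h M M.2)

theorem galHom_apply_eq_iff (σ : Gk k) (M : GL (Fin 2) (AlgebraicClosure k)) :
    galHom k σ M = M ↔ ∀ i j, σ (M.val i j) = M.val i j := by
  constructor
  · intro h i j
    exact congrArg (fun g : GL (Fin 2) (AlgebraicClosure k) => g.val i j) h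
  · intro h
    exact Units.ext (Matrix.ext h)

theorem stabSub_eq_fixingSubgroup (A : Subgroup (GL (Fin 2) (AlgebraicClosure k))) :
    stabSub A = (IntermediateField.adjoin k
      {x : AlgebraicClosure k | ∃ M ∈ A, ∃ i j, M.val i j = x}).fixingSubgroup := by
  ext σ
  rw [IntermediateField.mem_fixingSubgroup_iff]
  constructor
  · intro h x hx
    induction hx using IntermediateField.adjoin_induction with
    | mem x hx =>
      obtain ⟨M, hM, i, j, rfl⟩ := hx
      exact (galHom_apply_eq_iff σ M).1 (h M hM) i j
    | algebraMap x => exact σ.commutes x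
    | add x y _ _ hx hy => simp_all
    | inv x _ hx => simp_all
    | mul x y _ _ hx hy => simp_all
  · intro h M hM
    exact (galHom_apply_eq_iff σ M).2 fun i j =>
      h _ (IntermediateField.subset_adjoin k _ ⟨M, hM, i, j, rfl⟩)

theorem finrank_fixedField_stabSub [PerfectField k]
    (A : Subgroup (GL (Fin 2) (AlgebraicClosure k))) :
    Module.finrank k (IntermediateField.fixedField (stabSub A)) = (stabSub A).index := by
  rw [stabSub_eq_fixingSubgroup, InfiniteGalois.fixedField_fixingSubgroup,
    IntermediateField.finrank_eq_fixingSubgroup_index]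

/-- The action of `G_k` on a Galois-stable subgroup, transported along an isomorphism. -/
def galConj {D : Type*} [Group D] (A : Subgroup (GL (Fin 2) (AlgebraicClosure k)))
    (hA : ∀ σ : Gk k, ∀ M ∈ A, galHom k σ M ∈ A) (e : A ≃* D) : Gk k →* MulAut D :=
  (MulAut.congr e).toMonoidHom.comp (galStable A hA)

theorem galConj_apply {D : Type*} [Group D] (A : Subgroup (GL (Fin 2) (AlgebraicClosure k)))
    (hA : ∀ σ : Gk k, ∀ M ∈ A, galHom k σ M ∈ A) (e : A ≃* D) (σ : Gk k) (M : A) :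
    galConj A hA e σ (e M) = e (galStable A hA σ M) := by
  change e (galStable A hA σ (e.symm (e M))) = _
  rw [e.symm_apply_apply]

theorem finrank_fixedField_stabSub_eq_card_range [PerfectField k] {D : Type*} [Group D]
    (A : Subgroup (GL (Fin 2) (AlgebraicClosure k)))
    (hA : ∀ σ : Gk k, ∀ M ∈ A, galHom k σ M ∈ A) (e : A ≃* D) :
    Module.finrank k (IntermediateField.fixedField (stabSub A)) =
      Nat.card (galConj A hA e).range := by
  rw [finrank_fixedField_stabSub, ← Subgroup.index_ker, ← ker_galStable A hA]
  congr 1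
  ext σ
  exact (map_eq_one_iff (MulAut.congr e) (MulAut.congr e).injective).symm

end GaloisAction

/-- the image of the connecting map `δ`, `D12` case; Proposition 7 of
Cardona–Quer.  Let `A ≤ GL₂(k̄)` (char k ≠ 2, 3) be Galois-stable, abstractly isomorphic
to `D12`, with `K₁ = k(√u)`, and let `K` be the field of definition of the Galois action
on `A` (the fixed field of the pointwise stabilizer of `A`).  If `3 ∤ [K:k]` then `P(d)`
holds iff `d ∈ k*² ∪ u·k*²`; if `3 ∣ [K:k]` then `P(d)` holds iff `d ∈ k*²`.
Field equalities between fixed fields are expressed, via the Galois correspondence, as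
equalities of the corresponding subgroups of `G_k`. -/
theorem delta_image_D12 {k : Type*} [Field k] [PerfectField k]
    (hchar2 : (2 : k) ≠ 0) (hchar3 : (3 : k) ≠ 0)
    (A : Subgroup (GL (Fin 2) (AlgebraicClosure k)))
    (hstable : ∀ σ : Gk k, ∀ M ∈ A, galHom k σ M ∈ A)
    (hD12 : Nonempty (A ≃* DihedralGroup 6))
    (V : GL (Fin 2) (AlgebraicClosure k)) (hVA : V ∈ A) (hVord : orderOf V = 6)
    (u : k) (hu : u ≠ 0)
    (su : AlgebraicClosure k)
    (hsu : su ^ 2 = algebraMap k (AlgebraicClosure k) u)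
    -- `K₁ = k(√u)`:
    (hK1 : ∀ σ : Gk k,
      (∀ M ∈ A, galHom k σ M * M⁻¹ ∈
        ({1, V ^ 2, V ^ 4} : Set (GL (Fin 2) (AlgebraicClosure k)))) ↔ σ su = su) :
    -- the case `3 ∤ [K:k]`:
    ((¬ (3 ∣ Module.finrank k (IntermediateField.fixedField (stabSub A)))) →
      ∀ d : k, d ≠ 0 → ∀ sd : AlgebraicClosure k,
        sd ^ 2 = algebraMap k (AlgebraicClosure k) d →
        (Pcond k A sd ↔ ∃ c : k, c ≠ 0 ∧ (d = c ^ 2 ∨ d = u * c ^ 2))) ∧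
    -- the case `3 ∣ [K:k]`:
    ((3 ∣ Module.finrank k (IntermediateField.fixedField (stabSub A))) →
      ∀ d : k, d ≠ 0 → ∀ sd : AlgebraicClosure k,
        sd ^ 2 = algebraMap k (AlgebraicClosure k) d →
        (Pcond k A sd ↔ ∃ c : k, c ≠ 0 ∧ d = c ^ 2)) := by
  obtain ⟨e⟩ := hD12
  rw [finrank_fixedField_stabSub_eq_card_range A hstable e]
  set ρ := galConj A hstable e
  have hρe : ∀ σ M, ρ σ (e M) = e (galStable A hstable σ M) := galConj_apply A hstable e
  have hVe : orderOf (e ⟨V, hVA⟩) = 6 := by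
    rw [MulEquiv.orderOf_eq, ← hVord, ← Subgroup.orderOf_coe]
  obtain ⟨v, hv⟩ : ∃ v, e ⟨V, hVA⟩ = DihedralGroup.r v ∧ (v = 1 ∨ v = 5) :=
    DihedralGroup.eq_r_of_orderOf_eq_six hVe
  have hneg : e.symm (DihedralGroup.r 3) = (-1 : GL (Fin 2) (AlgebraicClosure k)) := by
    have hval : ∀ x y : DihedralGroup 6,
        ((e.symm (x * y) : A) : GL (Fin 2) (AlgebraicClosure k)) = e.symm x * e.symm y :=
      fun x y => by rw [map_mul, Subgroup.coe_mul]
    have hinj : ∀ x y : DihedralGroup 6,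
        ((e.symm x : A) : GL (Fin 2) (AlgebraicClosure k)) = e.symm y → x = y :=
      fun x y h => e.symm.injective (Subtype.ext h)
    apply Matrix.GeneralLinearGroup.eq_neg_one_of_central_involution
      (X := e.symm (DihedralGroup.r 1)) (Y := e.symm (DihedralGroup.sr 0))
    · rw [← hval, ← hval]
      exact fun h => absurd (hinj _ _ h) (by decide)
    · rw [← hval, ← hval]
      exact congrArg _ (congrArg _ (by decide))
    · rw [← hval, ← hval]
      exact congrArg _ (congrArg _ (by decide))
    · rw [← hval, ← Subgroup.coe_one A, ← map_one e.symm]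
      exact congrArg _ (congrArg _ (by decide))
    · rw [← Subgroup.coe_one A, ← map_one e.symm]
      exact fun h => absurd (hinj _ _ h) (by decide)
  have hP : ∀ sd, Pcond k A sd ↔ ∃ w, ∀ σ : Gk k, (σ sd = sd ∧ ρ σ w = w) ∨
      (σ sd = -sd ∧ ρ σ w = DihedralGroup.r 3 * w) := by
    intro sd
    have h1 : ∀ (σ : Gk k) (W : A), galHom k σ W = W ↔ ρ σ (e W) = e W := fun σ W => by
      rw [hρe, e.injective.eq_iff, Subtype.ext_iff, coe_galStable_apply]
    have h2 : ∀ (σ : Gk k) (W : A), galHom k σ W = -W ↔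
        ρ σ (e W) = DihedralGroup.r 3 * e W := fun σ W => by
      rw [hρe, ← e.eq_symm_apply, map_mul, e.symm_apply_apply, Subtype.ext_iff,
        Subgroup.coe_mul, hneg, coe_galStable_apply, neg_one_mul]
    constructor
    · rintro ⟨W, hW, h⟩
      refine ⟨e ⟨W, hW⟩, fun σ => ?_⟩
      rw [← h1, ← h2]
      exact h σ
    · rintro ⟨w, h⟩
      refine ⟨e.symm w, (e.symm w).2, fun σ => ?_⟩
      rw [h1, h2, e.apply_symm_apply]
      exact h σ
  have hK : ∀ σ : Gk k, (∀ m, ρ σ m * m⁻¹ = 1 ∨ ρ σ m * m⁻¹ = DihedralGroup.r 2 ∨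
      ρ σ m * m⁻¹ = DihedralGroup.r 4) ↔ σ su = su := by
    intro σ
    rw [← hK1, ← e.toEquiv.forall_congr_right, Subtype.forall]
    refine forall₂_congr fun M hM => ?_
    set x : A := galStable A hstable σ ⟨M, hM⟩ * ⟨M, hM⟩⁻¹
    have hxc : (x : GL (Fin 2) (AlgebraicClosure k)) = galHom k σ M * M⁻¹ := rfl
    have hpow : ∀ n : ℕ, galHom k σ M * M⁻¹ = V ^ n ↔ e x = e ⟨V, hVA⟩ ^ n := fun n => by
      rw [← hxc, ← map_pow, e.injective.eq_iff, Subtype.ext_iff, Subgroup.coe_pow]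
    have hone := hpow 0
    rw [pow_zero, pow_zero] at hone
    rw [Set.mem_insert_iff, Set.mem_insert_iff, Set.mem_singleton_iff, hone, hpow, hpow, hv.1]
    have hgoal : ρ σ (e.toEquiv ⟨M, hM⟩) * (e.toEquiv ⟨M, hM⟩)⁻¹ = e x := by
      rw [map_mul, map_inv, ← hρe]
      rfl
    rw [hgoal]
    rcases hv.2 with rfl | rfl
    · exact Iff.rfl
    · exact or_congr_right or_comm
  have hone : ∀ d : k, d ≠ 0 → ∀ sd : AlgebraicClosure k,
      sd ^ 2 = algebraMap k (AlgebraicClosure k) d → (∃ c : k, c ≠ 0 ∧ d = c ^ 2) →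
      Pcond k A sd := fun d hd sd hsd hc => by
    rw [hP]
    exact ⟨1, fun σ => Or.inl ⟨(isSquare_iff_sqrt_fixed hd hsd).1 hc σ, map_one _⟩⟩
  have hrot : ∀ d : k, d ≠ 0 → ∀ sd : AlgebraicClosure k,
      sd ^ 2 = algebraMap k (AlgebraicClosure k) d → ∀ i, (∀ σ : Gk k,
        (σ sd = sd ∧ ρ σ (DihedralGroup.r i) = DihedralGroup.r i) ∨
        (σ sd = -sd ∧ ρ σ (DihedralGroup.r i) = DihedralGroup.r 3 * DihedralGroup.r i)) →
      ∃ c : k, c ≠ 0 ∧ d = c ^ 2 := fun d hd sd hsd i h => by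
    refine (isSquare_iff_sqrt_fixed hd hsd).2 fun σ => ?_
    rcases h σ with h | h
    · exact h.1
    · exact absurd h.2 (DihedralGroup.apply_r_ne _ _)
  constructor
  · intro h3 d hd sd hsd
    constructor
    · intro h
      obtain ⟨w, hw⟩ := (hP sd).1 h
      rcases w with i | i
      · obtain ⟨c, hc, h⟩ := hrot d hd sd hsd i hw
        exact ⟨c, hc, Or.inl h⟩
      · obtain ⟨c, hc, h⟩ := (eq_mul_sq_iff_sqrt_fixed_iff hchar2 hd hu hsd hsu).2 fun σ => by
          rw [← hK, DihedralGroup.forall_mul_inv_mem_iff _ i ((hw σ).imp And.right And.right)]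
          rcases hw σ with h | h
          · exact iff_of_true h.1 h.2
          · rw [h.1, h.2]
            exact iff_of_false (sqrt_ne_neg hchar2 hd hsd).symm (DihedralGroup.r_three_mul_ne _)
        exact ⟨c, hc, Or.inr h⟩
    · rintro ⟨c, hc, h | h⟩
      · exact hone d hd sd hsd ⟨c, hc, h⟩
      · obtain ⟨i, hi⟩ := DihedralGroup.exists_reflection_stable_up_to_center ρ h3
        rw [hP]
        refine ⟨DihedralGroup.sr i, fun σ => ?_⟩
        have hiff := (eq_mul_sq_iff_sqrt_fixed_iff hchar2 hd hu hsd hsu).1 ⟨c, hc, h⟩ σ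
        rw [← hK, DihedralGroup.forall_mul_inv_mem_iff _ i (hi σ)] at hiff
        by_cases hσ : σ sd = sd
        · exact Or.inl ⟨hσ, hiff.1 hσ⟩
        · exact Or.inr ⟨(apply_sqrt_eq_or_neg hsd σ).resolve_left hσ,
            (hi σ).resolve_left (mt hiff.2 hσ)⟩
  · intro h3 d hd sd hsd
    refine ⟨fun h => ?_, hone d hd sd hsd⟩
    obtain ⟨w, hw⟩ := (hP sd).1 h
    rcases w with i | i
    · exact hrot d hd sd hsd i hw
    · obtain ⟨σ, hσ⟩ := DihedralGroup.exists_moves_reflections ρ h3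
      exact absurd ((hw σ).imp And.right And.right) (hσ i)

end
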